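/- For every real t with -1 ≤ t < 1, the Legendre expansion of the Cui–Freeden kernel holds: the series Σ_{n=1}^{∞} P_n(t)/(n(n+1)) converges and equals 1 - 2·ln( 1 + √((1-t)/2) ). Equivalently, the kernel K(t) = 1 - 2·ln(1 + √((1-t)/2)) has the expansion K(t) = Σ_{n=1}^{∞} ((2n+1)/(n(n+1)(2n+1)))·P_n(t), so its Legendre symbol is A_n^2 = n(n+1)(2n+1). -/

import Mathlib

open Polynomial

/-- The `n`-th Legendre polynomial, defined via Rodrigues' formula
`P n = (1/(2^n n!)) * d^n/dx^n (x^2 - 1)^n`. -/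
noncomputable def legendre (n : ℕ) : Polynomial ℝ :=
  C (1 / ((2 : ℝ) ^ n * n.factorial)) * derivative^[n] ((X ^ 2 - 1) ^ n)

theorem derivative_sq_sub_one_pow_succ (n : ℕ) :
    derivative ((X ^ 2 - 1 : ℝ[X]) ^ (n + 1)) = (2 * (n + 1) : ℝ) • ((X ^ 2 - 1) ^ n * X) := by
  rw [derivative_pow_succ]
  simp only [smul_eq_C_mul, derivative_sub, derivative_X_pow, derivative_one, map_mul, map_add,
    map_natCast, map_one, map_ofNat]
  push_cast
  ring

theorem legendre_eq_smul (n : ℕ) :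
    legendre n = (1 / ((2 : ℝ) ^ n * n.factorial)) • derivative^[n] ((X ^ 2 - 1) ^ n) := by
  rw [legendre, smul_eq_C_mul]

theorem rodrigues_coeff_succ (n : ℕ) :
    1 / ((2 : ℝ) ^ (n + 1) * (n + 1).factorial) * (2 * (n + 1)) =
      1 / ((2 : ℝ) ^ n * n.factorial) := by
  have : (n.factorial : ℝ) ≠ 0 := by positivity
  rw [Nat.factorial_succ]
  push_cast
  field_simp
  ring

theorem legendre_succ (n : ℕ) :
    legendre (n + 1) = X * legendre n +
      (n / ((2 : ℝ) ^ n * n.factorial)) • derivative^[n - 1] ((X ^ 2 - 1) ^ n) := by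
  rw [legendre_eq_smul, Function.iterate_succ_apply, derivative_sq_sub_one_pow_succ,
    iterate_derivative_smul, smul_smul, rodrigues_coeff_succ, iterate_derivative_mul_X,
    legendre_eq_smul]
  simp only [smul_eq_C_mul, nsmul_eq_mul, div_eq_mul_inv, map_mul, map_natCast, one_mul]
  ring

theorem derivative_legendre_succ (n : ℕ) :
    derivative (legendre (n + 1)) =
      ((n : ℝ) + 1) • legendre n + X * derivative (legendre n) := by
  rw [legendre_eq_smul (n + 1), derivative_smul,
    ← Function.iterate_succ_apply' derivative, Function.iterate_succ_apply, derivative_sq_sub_one_pow_succ,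
    iterate_derivative_smul, smul_smul, rodrigues_coeff_succ, iterate_derivative_mul_X,
    legendre_eq_smul, derivative_smul, ← Function.iterate_succ_apply' derivative]
  simp only [smul_eq_C_mul, nsmul_eq_mul, map_add, map_natCast, map_one, Nat.add_sub_cancel,
    Nat.succ_eq_add_one]
  push_cast
  ring

theorem sq_sub_one_mul_iterate_derivative (n : ℕ) :
    (X ^ 2 - 1 : ℝ[X]) * derivative^[n + 1] ((X ^ 2 - 1) ^ n) =
      ((n : ℝ) * (n + 1)) • derivative^[n - 1] ((X ^ 2 - 1) ^ n) := by
  rcases n with _ | n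
  · simp
  set u : ℝ[X] := (X ^ 2 - 1) ^ (n + 1) with hu
  have hode : derivative u * X * X - derivative u = (2 * (n + 1) : ℝ) • (u * X) := by
    rw [hu, derivative_sq_sub_one_pow_succ]
    simp only [smul_eq_C_mul]
    ring
  have h := congrArg (fun p => derivative^[n + 1] p) hode
  simp only [iterate_derivative_sub, iterate_derivative_smul, iterate_derivative_mul_X,
    Nat.add_sub_cancel, ← Function.iterate_succ_apply derivative, Nat.succ_eq_add_one] at h
  simp only [smul_eq_C_mul, nsmul_eq_mul, map_add, map_natCast, map_one, map_mul, map_ofNat,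
    Nat.add_sub_cancel] at h ⊢
  rcases n with _ | n
  · push_cast at h ⊢
    simp at h ⊢
    linear_combination h
  · simp only [Nat.add_sub_cancel] at h
    push_cast at h ⊢
    linear_combination h

theorem sq_sub_one_mul_derivative_legendre (n : ℕ) :
    (X ^ 2 - 1 : ℝ[X]) * derivative (legendre n) =
      ((n : ℝ) + 1) • (legendre (n + 1) - X * legendre n) := by
  rw [legendre_succ, add_sub_cancel_left, legendre_eq_smul, derivative_smul,
    ← Function.iterate_succ_apply' derivative, mul_smul_comm, sq_sub_one_mul_iterate_derivative,
    smul_smul, smul_smul]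
  congr 1
  ring

theorem legendre_bonnet (n : ℕ) :
    ((n : ℝ) + 2) • legendre (n + 2) =
      (2 * (n : ℝ) + 3) • (X * legendre (n + 1)) - ((n : ℝ) + 1) • legendre n := by
  have h₀ := sq_sub_one_mul_derivative_legendre n
  have h₁ := sq_sub_one_mul_derivative_legendre (n + 1)
  rw [derivative_legendre_succ] at h₁
  simp only [smul_eq_C_mul, map_add, map_natCast, map_one, map_mul, map_ofNat] at h₀ h₁ ⊢
  push_cast at h₀ h₁ ⊢
  linear_combination X * h₀ - h₁

theorem derivative_sq_sub_one_mul_derivative_legendre (n : ℕ) :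
    derivative ((X ^ 2 - 1) * derivative (legendre n)) =
      ((n : ℝ) * (n + 1)) • legendre n := by
  rw [sq_sub_one_mul_derivative_legendre, derivative_smul, derivative_sub,
    derivative_legendre_succ, derivative_mul, derivative_X]
  simp only [smul_eq_C_mul, map_add, map_natCast, map_one, map_mul]
  ring

theorem legendre_zero : legendre 0 = 1 := by
  simp [legendre]

theorem legendre_one : legendre 1 = X := by
  simpa [legendre_zero] using legendre_succ 0

theorem sq_eval_legendre_of_sq_eq_one {x : ℝ} (hx : x ^ 2 = 1) (n : ℕ) :
    ((legendre n).eval x) ^ 2 = 1 := by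
  induction n with
  | zero => simp [legendre_zero]
  | succ n ih =>
    have h := congrArg (eval x) (sq_sub_one_mul_derivative_legendre n)
    simp only [eval_mul, eval_sub, eval_pow, eval_X, eval_one, hx, sub_self, zero_mul, eval_smul,
      smul_eq_mul] at h
    have hn : (n : ℝ) + 1 ≠ 0 := by positivity
    have h' : (legendre (n + 1)).eval x = x * (legendre n).eval x := by
      rcases mul_eq_zero.1 h.symm with h | h
      · exact absurd h hn
      · linarith
    rw [h', mul_pow, hx, ih, one_mul]

theorem abs_eval_legendre_le_one (n : ℕ) {x : ℝ} (hx₁ : -1 ≤ x) (hx₂ : x ≤ 1) :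
    |(legendre n).eval x| ≤ 1 := by
  rcases n.eq_zero_or_pos with rfl | hn
  · simp [legendre_zero]
  have hn' : (0 : ℝ) < n * (n + 1) := by positivity
  rw [← sq_le_one_iff_abs_le_one]
  let E : ℝ[X] := ((n : ℝ) * (n + 1)) • legendre n ^ 2 +
    (1 - X ^ 2) * derivative (legendre n) ^ 2
  have hE : derivative E = 2 * X * derivative (legendre n) ^ 2 := by
    have h := derivative_sq_sub_one_mul_derivative_legendre n
    rw [derivative_add, derivative_smul]
    simp only [derivative_mul, derivative_sub, derivative_X, derivative_one, derivative_pow,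
      smul_eq_C_mul, map_mul, map_add, map_natCast, map_one] at h ⊢
    norm_num at h ⊢
    linear_combination (-2 * derivative (legendre n)) * h
  have hcont (s : Set ℝ) : ContinuousOn (fun y => E.eval y) s := E.continuous.continuousOn
  have hdiff (s : Set ℝ) : DifferentiableOn ℝ (fun y => E.eval y) s :=
    E.differentiable.differentiableOn
  have hderiv (y : ℝ) : deriv (fun y => E.eval y) y =
      2 * y * ((derivative (legendre n)).eval y) ^ 2 := by
    rw [Polynomial.deriv, hE]
    simp
  have hend {y : ℝ} (hy : y ^ 2 = 1) : E.eval y = n * (n + 1) := by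
    simp [E, hy, sq_eval_legendre_of_sq_eq_one hy]
  have hle : E.eval x ≤ n * (n + 1) := by
    rcases le_total 0 x with h0 | h0
    · have hmono : MonotoneOn (fun y => E.eval y) (Set.Icc 0 1) := by
        refine monotoneOn_of_deriv_nonneg (convex_Icc 0 1) (hcont _) (hdiff _) fun y hy => ?_
        rw [interior_Icc] at hy
        rw [hderiv]
        have := hy.1
        positivity
      rw [← hend (one_pow 2)]
      exact hmono ⟨h0, hx₂⟩ ⟨zero_le_one, le_rfl⟩ hx₂
    · have hanti : AntitoneOn (fun y => E.eval y) (Set.Icc (-1) 0) := by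
        refine antitoneOn_of_deriv_nonpos (convex_Icc (-1) 0) (hcont _) (hdiff _) fun y hy => ?_
        rw [interior_Icc] at hy
        rw [hderiv]
        exact mul_nonpos_of_nonpos_of_nonneg (by linarith [hy.2]) (sq_nonneg _)
      rw [← hend (y := -1) (by norm_num)]
      exact hanti ⟨le_rfl, by norm_num⟩ ⟨hx₁, h0⟩ hx₁
  have hEx : E.eval x = n * (n + 1) * (legendre n).eval x ^ 2 +
      (1 - x ^ 2) * (derivative (legendre n)).eval x ^ 2 := by
    simp [E]
  have hsq : 0 ≤ (1 - x ^ 2) * (derivative (legendre n)).eval x ^ 2 :=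
    mul_nonneg (by nlinarith) (sq_nonneg _)
  refine le_of_mul_le_mul_left ?_ hn'
  linarith

theorem eq_of_hasDerivAt_zero {f : ℝ → ℝ} {a b : ℝ} (hab : a ≤ b)
    (hf : ContinuousOn f (Set.Icc a b)) (hf' : ∀ x ∈ Set.Ioo a b, HasDerivAt f 0 x) :
    f a = f b := by
  rcases hab.eq_or_lt with rfl | hab
  · rfl
  obtain ⟨c, -, hc⟩ := exists_hasDerivAt_eq_slope f 0 hab hf hf'
  rcases div_eq_zero_iff.1 hc.symm with h | h <;> linarith

theorem summable_mul_pow_of_abs_le_one {p : ℕ → ℝ} (hp : ∀ n, |p n| ≤ 1)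
    {r : ℝ} (hr : |r| < 1) : Summable fun n => p n * r ^ n := by
  refine .of_norm_bounded (summable_geometric_of_abs_lt_one (r := |r|) (by simpa)) fun n => ?_
  rw [norm_mul, norm_pow]
  exact mul_le_of_le_one_left (by positivity) (hp n)

theorem summable_natCast_mul_pow_pred {r : ℝ} (hr : |r| < 1) :
    Summable fun n : ℕ => (n : ℝ) * r ^ (n - 1) := by
  rw [← summable_nat_add_iff 1]
  have h₁ := summable_pow_mul_geometric_of_norm_lt_one 1 (r := r) hr
  have h₂ := summable_geometric_of_abs_lt_one hr
  refine (h₁.add h₂).congr fun n => ?_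
  simp only [Nat.add_sub_cancel, Nat.cast_add, Nat.cast_one]
  ring

theorem summable_mul_natCast_mul_pow_pred {p : ℕ → ℝ} (hp : ∀ n, |p n| ≤ 1)
    {r : ℝ} (hr : |r| < 1) :
    Summable fun n : ℕ => p n * (n * r ^ (n - 1)) := by
  refine .of_norm_bounded (summable_natCast_mul_pow_pred (r := |r|) (by simpa)) fun n => ?_
  rw [norm_mul, norm_mul, norm_pow, RCLike.norm_natCast]
  exact mul_le_of_le_one_left (by positivity) (hp n)

theorem hasDerivAt_tsum_mul_pow {p : ℕ → ℝ} (hp : ∀ n, |p n| ≤ 1)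
    {r : ℝ} (hr : |r| < 1) :
    HasDerivAt (fun z => ∑' n, p n * z ^ n) (∑' n : ℕ, p n * (n * r ^ (n - 1))) r := by
  obtain ⟨ρ, hrρ, hρ⟩ := exists_between hr
  have hρ₀ : 0 < ρ := (abs_nonneg r).trans_lt hrρ
  refine hasDerivAt_tsum_of_isPreconnected (t := Set.Ioo (-ρ) ρ) (y₀ := 0)
    (summable_natCast_mul_pow_pred (by rwa [abs_of_pos hρ₀])) isOpen_Ioo
    isPreconnected_Ioo (fun n y _ => (hasDerivAt_pow n y).const_mul _) (fun n y hy => ?_)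
    (by simpa) (summable_mul_pow_of_abs_le_one hp (by simp)) (abs_lt.1 hrρ)
  rw [norm_mul, norm_mul, norm_pow, RCLike.norm_natCast]
  have : |y| ≤ ρ := (abs_lt.2 hy).le
  calc ‖p n‖ * (n * ‖y‖ ^ (n - 1)) ≤ n * ‖y‖ ^ (n - 1) :=
        mul_le_of_le_one_left (by positivity) (hp n)
    _ ≤ n * ρ ^ (n - 1) := by rw [Real.norm_eq_abs]; gcongr

theorem hasDerivAt_tsum_mul_pow_div_sub {p : ℕ → ℝ} (hp : ∀ n, |p n| ≤ 1)
    {r : ℝ} (hr₀ : 0 < r) (hr₁ : r < 1) :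
    HasDerivAt
      (fun z => ∑' n : ℕ, p (n + 1) * (z ^ (n + 1) / (n + 1) - z ^ (n + 2) / (n + 2)))
      ((∑' n, p n * r ^ n - p 0) * (1 - r) / r) r := by
  obtain ⟨ρ, hrρ, hρ⟩ := exists_between hr₁
  have hρ₀ : 0 < ρ := hr₀.trans hrρ
  have hsum := summable_mul_pow_of_abs_le_one hp (r := r) (by rwa [abs_of_pos hr₀])
  have hval : ((∑' n, p n * r ^ n - p 0) * (1 - r) / r) =
      ∑' n, p (n + 1) * (r ^ n - r ^ (n + 1)) := by
    rw [hsum.tsum_eq_zero_add, pow_zero, mul_one, add_sub_cancel_left, ← tsum_mul_right,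
      ← tsum_div_const]
    refine tsum_congr fun n => ?_
    field_simp
    ring
  rw [hval]
  have hderiv (n : ℕ) (y : ℝ) : HasDerivAt
      (fun z => p (n + 1) * (z ^ (n + 1) / (n + 1) - z ^ (n + 2) / (n + 2)))
      (p (n + 1) * (y ^ n - y ^ (n + 1))) y := by
    have h₁ := (hasDerivAt_pow (n + 1) y).div_const ((n : ℝ) + 1)
    have h₂ := (hasDerivAt_pow (n + 2) y).div_const ((n : ℝ) + 2)
    refine ((h₁.sub h₂).const_mul (p (n + 1))).congr_deriv ?_
    simp only [Nat.add_sub_cancel, Nat.add_succ_sub_one, Nat.cast_add, Nat.cast_one,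
      Nat.cast_ofNat]
    field_simp
  have hbound (n : ℕ) (y : ℝ) (hy : y ∈ Set.Ioo 0 ρ) :
      ‖p (n + 1) * (y ^ n - y ^ (n + 1))‖ ≤ ρ ^ n := by
    have hy₀ : 0 ≤ y := hy.1.le
    have hnn : 0 ≤ y ^ n - y ^ (n + 1) := by
      rw [pow_succ]
      nlinarith [pow_nonneg hy₀ n, hy.2]
    rw [norm_mul, Real.norm_of_nonneg hnn]
    calc ‖p (n + 1)‖ * (y ^ n - y ^ (n + 1)) ≤ y ^ n - y ^ (n + 1) :=
          mul_le_of_le_one_left hnn (hp _)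
      _ ≤ y ^ n := sub_le_self _ (by positivity)
      _ ≤ ρ ^ n := pow_le_pow_left₀ hy₀ hy.2.le n
  have hbase : Summable fun n : ℕ =>
      p (n + 1) * (r ^ (n + 1) / (n + 1) - r ^ (n + 2) / (n + 2)) := by
    refine .of_norm_bounded ((summable_geometric_of_lt_one hr₀.le hr₁).add
      (summable_geometric_of_lt_one hr₀.le hr₁)) fun n => ?_
    rw [norm_mul]
    refine (mul_le_of_le_one_left (norm_nonneg _) (hp _)).trans ((norm_sub_le _ _).trans ?_)
    have hle (k : ℕ) {c : ℝ} (hc : 1 ≤ c) : ‖r ^ (n + k) / c‖ ≤ r ^ n := by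
      rw [Real.norm_of_nonneg (by positivity)]
      exact (div_le_self (by positivity) hc).trans
        (pow_le_pow_of_le_one hr₀.le hr₁.le (Nat.le_add_right n k))
    exact add_le_add (hle 1 (by linarith [n.cast_nonneg (α := ℝ)]))
      (hle 2 (by linarith [n.cast_nonneg (α := ℝ)]))
  exact hasDerivAt_tsum_of_isPreconnected (summable_geometric_of_lt_one hρ₀.le hρ) isOpen_Ioo
    isPreconnected_Ioo (fun n y _ => hderiv n y) hbound ⟨hr₀, hrρ⟩ hbase ⟨hr₀, hrρ⟩

theorem summable_one_div_succ_mul_add_two :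
    Summable fun n : ℕ => 1 / (((n : ℝ) + 1) * (n + 2)) := by
  refine .of_nonneg_of_le (fun n => by positivity) (fun n => ?_)
    ((summable_nat_add_iff 1).2 (Real.summable_one_div_nat_pow.2 one_lt_two))
  push_cast
  rw [sq]
  gcongr
  norm_num

theorem add_one_mul_pow_sub_le_one (n : ℕ) {z : ℝ} (hz : 0 ≤ z) :
    (n + 1) * z ^ n - n * z ^ (n + 1) ≤ 1 := by
  induction n with
  | zero => simp
  | succ n ih =>
    have h : 0 ≤ (n + 1) * z ^ n * (1 - z) ^ 2 := by positivity
    push_cast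
    linear_combination ih + h

theorem continuousOn_tsum_mul_pow_div_sub {p : ℕ → ℝ} (hp : ∀ n, |p n| ≤ 1) : ContinuousOn
    (fun z : ℝ => ∑' n : ℕ, p (n + 1) * (z ^ (n + 1) / (n + 1) - z ^ (n + 2) / (n + 2)))
    (Set.Icc 0 1) := by
  refine continuousOn_tsum (fun n => by fun_prop) summable_one_div_succ_mul_add_two ?_
  intro n z hz
  have hn : (0 : ℝ) < n + 1 := by positivity
  have hn' : (0 : ℝ) < n + 2 := by positivity
  have hpow : 0 ≤ z ^ (n + 1) := pow_nonneg hz.1 _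
  have hnn : 0 ≤ z ^ (n + 1) / (n + 1) - z ^ (n + 2) / (n + 2) := by
    rw [sub_nonneg]
    exact div_le_div₀ hpow (pow_le_pow_of_le_one hz.1 hz.2 (by omega)) hn (by linarith)
  rw [norm_mul, Real.norm_of_nonneg hnn]
  refine (mul_le_of_le_one_left hnn (hp _)).trans ?_
  have h := add_one_mul_pow_sub_le_one (n + 1) hz.1
  rw [div_sub_div _ _ hn.ne' hn'.ne']
  gcongr
  push_cast at h
  linarith

theorem legendre_ode {t r : ℝ} (ht₁ : -1 ≤ t) (ht₂ : t ≤ 1) (hr : |r| < 1) :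
    (1 - 2 * t * r + r ^ 2) * ∑' n : ℕ, (legendre n).eval t * (n * r ^ (n - 1)) =
      (t - r) * ∑' n, (legendre n).eval t * r ^ n := by
  have hp n := abs_eval_legendre_le_one n ht₁ ht₂
  have ha := summable_mul_pow_of_abs_le_one hp hr
  have hb := summable_mul_natCast_mul_pow_pred hp hr
  set a := ∑' n, (legendre n).eval t * r ^ n with ha_def
  set b := ∑' n : ℕ, (legendre n).eval t * (n * r ^ (n - 1)) with hb_def
  have ha₁ := (hasSum_nat_add_iff' 1).2 ha.hasSum
  have hb₁ := (hasSum_nat_add_iff' 1).2 hb.hasSum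
  have hb₂ := (hasSum_nat_add_iff' 2).2 hb.hasSum
  simp only [← ha_def, ← hb_def, Finset.sum_range_succ, Finset.sum_range_zero, legendre_zero,
    legendre_one, eval_one, eval_X] at ha₁ hb₁ hb₂
  have hrhs := ((hb₁.mul_left (2 * t * r)).add (ha₁.mul_left t)).sub
    ((hb.hasSum.mul_left (r ^ 2)).add (ha.hasSum.mul_left r))
  have hterm (n : ℕ) : (legendre (n + 2)).eval t * (((n + 2 : ℕ) : ℝ) * r ^ (n + 2 - 1)) =
      2 * t * r * ((legendre (n + 1)).eval t * (((n + 1 : ℕ) : ℝ) * r ^ (n + 1 - 1))) +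
        t * ((legendre (n + 1)).eval t * r ^ (n + 1)) -
        (r ^ 2 * ((legendre n).eval t * (n * r ^ (n - 1))) +
          r * ((legendre n).eval t * r ^ n)) := by
    have h := congrArg (eval t) (legendre_bonnet n)
    simp only [eval_smul, eval_sub, eval_mul, eval_X, smul_eq_mul] at h
    have hpow : (n : ℝ) * r ^ (n + 1) = r ^ 2 * (n * r ^ (n - 1)) := by
      rcases n with _ | n
      · simp
      · rw [Nat.add_sub_cancel]
        ring
    simp only [Nat.add_sub_cancel, Nat.add_succ_sub_one, Nat.cast_add, Nat.cast_one,
      Nat.cast_ofNat]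
    linear_combination r ^ (n + 1) * h - (legendre n).eval t * hpow
  simp only [hterm] at hb₂
  have h := hb₂.unique hrhs
  simp at h
  linear_combination h

theorem one_sub_two_mul_mul_add_sq_pos {t r : ℝ} (ht₂ : t < 1) (hr₀ : 0 ≤ r) :
    0 < 1 - 2 * t * r + r ^ 2 := by
  rcases hr₀.eq_or_lt with rfl | hr
  · norm_num
  · nlinarith [mul_pos hr (sub_pos.2 ht₂), sq_nonneg (1 - r)]

theorem hasDerivAt_sqrt_one_sub_two_mul_mul_add_sq {t r : ℝ} (ht₂ : t < 1) (hr₀ : 0 ≤ r) :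
    HasDerivAt (fun z => √(1 - 2 * t * z + z ^ 2)) ((r - t) / √(1 - 2 * t * r + r ^ 2)) r := by
  have h : HasDerivAt (fun z : ℝ => 1 - 2 * t * z + z ^ 2) (-(2 * t * 1) + 2 * r) r := by
    refine ((((hasDerivAt_id r).const_mul (2 * t)).const_sub 1).add
      (hasDerivAt_pow 2 r)).congr_deriv ?_
    norm_num
  refine (h.sqrt (one_sub_two_mul_mul_add_sq_pos ht₂ hr₀).ne').congr_deriv ?_
  rw [show -(2 * t * 1) + 2 * r = 2 * (r - t) by ring, mul_div_mul_left _ _ two_ne_zero]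

theorem tsum_legendre_mul_pow {t r : ℝ} (ht₁ : -1 ≤ t) (ht₂ : t < 1) (hr₀ : 0 ≤ r)
    (hr₁ : r < 1) :
    ∑' n, (legendre n).eval t * r ^ n = 1 / √(1 - 2 * t * r + r ^ 2) := by
  have hp n := abs_eval_legendre_le_one n ht₁ ht₂.le
  let f (z : ℝ) : ℝ := (∑' n, (legendre n).eval t * z ^ n) * √(1 - 2 * t * z + z ^ 2)
  have hf (z : ℝ) (hz₀ : 0 ≤ z) (hz₁ : z < 1) : HasDerivAt f 0 z := by
    have hz : |z| < 1 := by rwa [abs_of_nonneg hz₀]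
    have hq := one_sub_two_mul_mul_add_sq_pos ht₂ hz₀
    refine ((hasDerivAt_tsum_mul_pow hp hz).mul
      (hasDerivAt_sqrt_one_sub_two_mul_mul_add_sq ht₂ hz₀)).congr_deriv ?_
    have hW := Real.sqrt_pos.2 hq
    have hsq := Real.sq_sqrt hq.le
    have hode := legendre_ode ht₁ ht₂.le hz
    rw [← hsq] at hode
    set a := ∑' n, (legendre n).eval t * z ^ n
    set b := ∑' n : ℕ, (legendre n).eval t * (n * z ^ (n - 1))
    field_simp
    linear_combination hode
  have h : f 0 = f r := eq_of_hasDerivAt_zero hr₀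
    (fun z hz => (hf z hz.1 (hz.2.trans_lt hr₁)).continuousAt.continuousWithinAt)
    fun z hz => hf z hz.1.le (hz.2.trans hr₁)
  have h0 : f 0 = 1 := by
    simp only [f]
    rw [tsum_eq_single 0 (fun n hn => by simp [hn])]
    simp [legendre_zero]
  rw [eq_div_iff (Real.sqrt_pos.2 (one_sub_two_mul_mul_add_sq_pos ht₂ hr₀)).ne']
  exact h.symm.trans h0

theorem one_sub_mul_add_sqrt_pos {t r : ℝ} (ht₂ : t < 1) (hr₀ : 0 ≤ r)
    (hr₁ : r ≤ 1) : 0 < 1 - t * r + √(1 - 2 * t * r + r ^ 2) := by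
  have := Real.sqrt_pos.2 (one_sub_two_mul_mul_add_sq_pos ht₂ hr₀)
  nlinarith

theorem sqrt_add_sub_pos {t r : ℝ} (ht₂ : t < 1) (hr₀ : 0 ≤ r) :
    0 < √(1 - 2 * t * r + r ^ 2) + r - t := by
  have hW := Real.sqrt_pos.2 (one_sub_two_mul_mul_add_sq_pos ht₂ hr₀)
  have hsq := Real.sq_sqrt (one_sub_two_mul_mul_add_sq_pos ht₂ hr₀).le
  rcases lt_or_ge r t with h | h
  · nlinarith
  · linarith

theorem hasDerivAt_kernel_primitive {t r : ℝ} (ht₂ : t < 1) (hr₀ : 0 < r)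
    (hr₁ : r < 1) :
    HasDerivAt
      (fun z => z - Real.log (1 - t * z + √(1 - 2 * t * z + z ^ 2)) -
        Real.log (√(1 - 2 * t * z + z ^ 2) + z - t))
      ((1 / √(1 - 2 * t * r + r ^ 2) - 1) * (1 - r) / r) r := by
  have hq := one_sub_two_mul_mul_add_sq_pos ht₂ hr₀.le
  have hW' := hasDerivAt_sqrt_one_sub_two_mul_mul_add_sq ht₂ hr₀.le
  have hA := one_sub_mul_add_sqrt_pos ht₂ hr₀.le hr₁.le
  have hB := sqrt_add_sub_pos ht₂ hr₀.le
  have hlogA := (((hasDerivAt_id r).const_mul t).const_sub 1 |>.add hW').log hA.ne'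
  have hlogB := ((hW'.add (hasDerivAt_id r)).sub_const t).log hB.ne'
  refine (((hasDerivAt_id r).sub hlogA).sub hlogB).congr_deriv ?_
  simp only [id, Pi.add_apply]
  have hW := Real.sqrt_pos.2 hq
  have hsq := Real.sq_sqrt hq.le
  set W := √(1 - 2 * t * r + r ^ 2)
  have h₁ : (-(t * 1) + (r - t) / W) / (1 - t * r + W) = (W - 1) / (r * W) := by
    rw [div_eq_div_iff hA.ne' (by positivity)]
    field_simp
    linear_combination (-1 : ℝ) * hsq
  have h₂ : ((r - t) / W + 1) / (W + r - t) = 1 / W := by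
    rw [div_eq_div_iff hB.ne' hW.ne']
    field_simp
    ring
  rw [h₁, h₂]
  field_simp
  ring

theorem kernel_primitive_one_sub_zero {t : ℝ} (ht₂ : t < 1) :
    (1 - Real.log (1 - t + √(2 - 2 * t)) - Real.log (√(2 - 2 * t) + 1 - t)) -
      (0 - Real.log 2 - Real.log (1 - t)) = 1 - 2 * Real.log (1 + √((1 - t) / 2)) := by
  have hs : 0 < √((1 - t) / 2) := Real.sqrt_pos.2 (by linarith)
  have hsq := Real.sq_sqrt (show 0 ≤ (1 - t) / 2 by linarith)
  set s := √((1 - t) / 2)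
  have ht : 1 - t = 2 * s ^ 2 := by linarith
  have hW : √(2 - 2 * t) = 2 * s := by
    rw [Real.sqrt_eq_iff_mul_self_eq (by linarith) (by positivity)]
    linear_combination 2 * ht
  rw [hW, add_sub_assoc, ht, add_comm (2 * s),
    show 2 * s ^ 2 + 2 * s = 2 * s * (1 + s) by ring,
    Real.log_mul (by positivity) (by positivity), Real.log_mul two_ne_zero hs.ne',
    Real.log_mul two_ne_zero (by positivity), Real.log_pow]
  push_cast
  ring

theorem tsum_legendre_succ_div {t : ℝ} (ht₁ : -1 ≤ t) (ht₂ : t < 1) :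
    ∑' n : ℕ, (legendre (n + 1)).eval t * (1 / ((n : ℝ) + 1) - 1 / (n + 2)) =
      1 - 2 * Real.log (1 + √((1 - t) / 2)) := by
  have hp n := abs_eval_legendre_le_one n ht₁ ht₂.le
  let F (z : ℝ) : ℝ :=
    ∑' n : ℕ, (legendre (n + 1)).eval t * (z ^ (n + 1) / (n + 1) - z ^ (n + 2) / (n + 2))
  let G (z : ℝ) : ℝ := z - Real.log (1 - t * z + √(1 - 2 * t * z + z ^ 2)) -
    Real.log (√(1 - 2 * t * z + z ^ 2) + z - t)
  have hF : ContinuousOn F (Set.Icc 0 1) := continuousOn_tsum_mul_pow_div_sub hp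
  have hG : ContinuousOn G (Set.Icc 0 1) := by
    refine (continuousOn_id.sub (ContinuousOn.log (by fun_prop) fun z hz => ?_)).sub
      (ContinuousOn.log (by fun_prop) fun z hz => ?_)
    · exact (one_sub_mul_add_sqrt_pos ht₂ hz.1 hz.2).ne'
    · exact (sqrt_add_sub_pos ht₂ hz.1).ne'
  have h : F 0 - G 0 = F 1 - G 1 := by
    refine eq_of_hasDerivAt_zero (f := fun z => F z - G z) zero_le_one (hF.sub hG) fun z hz => ?_
    refine ((hasDerivAt_tsum_mul_pow_div_sub hp hz.1 hz.2).sub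
      (hasDerivAt_kernel_primitive ht₂ hz.1 hz.2)).congr_deriv ?_
    rw [tsum_legendre_mul_pow ht₁ ht₂ hz.1.le hz.2, legendre_zero, eval_one, sub_self]
  have hF₀ : F 0 = 0 := by simp [F]
  have hF₁ : F 1 = ∑' n : ℕ, (legendre (n + 1)).eval t * (1 / ((n : ℝ) + 1) - 1 / (n + 2)) := by
    simp [F]
  have hG₀ : G 0 = 0 - Real.log 2 - Real.log (1 - t) := by
    norm_num [G]
  have hG₁ : G 1 = 1 - Real.log (1 - t + √(2 - 2 * t)) - Real.log (√(2 - 2 * t) + 1 - t) := by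
    simp only [G]
    ring_nf
  rw [← hF₁, ← kernel_primitive_one_sub_zero ht₂, ← hG₀, ← hG₁]
  linarith

/-- Legendre expansion of the Cui–Freeden kernel: for `-1 ≤ t < 1`,
`Σ_{n=1}^∞ P_n(t)/(n(n+1)) = 1 - 2 ln(1 + √((1-t)/2))`;
so the Legendre symbol of the kernel `K(t) = 1 - 2 ln(1 + √((1-t)/2))`,
`K(t) = Σ_{n=1}^∞ ((2n+1)/(n(n+1)(2n+1))) P_n(t)`, is `A_n² = n(n+1)(2n+1)`. -/
theorem cui_freeden_kernel_expansion (t : ℝ) (ht₁ : -1 ≤ t) (ht₂ : t < 1) :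
    HasSum (fun n : ℕ => (legendre (n + 1)).eval t / (((n : ℝ) + 1) * ((n : ℝ) + 2)))
      (1 - 2 * Real.log (1 + Real.sqrt ((1 - t) / 2))) ∧
    1 - 2 * Real.log (1 + Real.sqrt ((1 - t) / 2)) =
      ∑' n : ℕ, (2 * ((n : ℝ) + 1) + 1) /
          (((n : ℝ) + 1) * ((n : ℝ) + 2) * (2 * ((n : ℝ) + 1) + 1)) *
        (legendre (n + 1)).eval t := by
  have hsum : Summable fun n : ℕ =>
      (legendre (n + 1)).eval t / (((n : ℝ) + 1) * ((n : ℝ) + 2)) := by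
    refine .of_norm_bounded summable_one_div_succ_mul_add_two fun n => ?_
    have hn : (0 : ℝ) < ((n : ℝ) + 1) * (n + 2) := by positivity
    rw [norm_div, Real.norm_of_nonneg hn.le]
    gcongr
    exact abs_eval_legendre_le_one (n + 1) ht₁ ht₂.le
  have htsum : ∑' n : ℕ, (legendre (n + 1)).eval t / (((n : ℝ) + 1) * ((n : ℝ) + 2)) =
      1 - 2 * Real.log (1 + √((1 - t) / 2)) := by
    rw [← tsum_legendre_succ_div ht₁ ht₂]
    refine tsum_congr fun n => ?_
    field_simp
    ring
  refine ⟨htsum ▸ hsum.hasSum, ?_⟩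
  rw [← htsum]
  refine tsum_congr fun n => ?_
  field_simp
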